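/- Let μ and ν be probability measures on compact subsets X and Y of ℝ^d, let f₀ : ℝ^d → ℝ be a convex differentiable function with (∇f₀)_#μ = ν, and set T₀ = ∇f₀. Let f : ℝ^d → ℝ be a C¹, γ-strongly convex function (γ > 0), so that f* is finite-valued and differentiable on ℝ^d. Then J_{μ,ν}(f) − J_{μ,ν}(f₀) = ∫ D_{f*}(T₀(x), ∇f(x)) dμ(x), where D_{f*}(a,b) = f*(a) − f*(b) − ⟨a − b, ∇f*(b)⟩ is the Bregman divergence associated with f*. -/

import Mathlib

open MeasureTheory
open scoped RealInnerProductSpace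

noncomputable def conj {d : ℕ} (f : EuclideanSpace ℝ (Fin d) → ℝ)
    (y : EuclideanSpace ℝ (Fin d)) : EReal :=
  ⨆ x : EuclideanSpace ℝ (Fin d), ((⟪x, y⟫ - f x : ℝ) : EReal)

open Classical in
/-- Integral of an `EReal`-valued function, valued in `(-∞, +∞]`:
it is the Bochner integral when the function is a.e. finite and integrable, `+∞` otherwise. -/
noncomputable def eintegral {d : ℕ} (ν : Measure (EuclideanSpace ℝ (Fin d)))
    (g : EuclideanSpace ℝ (Fin d) → EReal) : EReal :=
  if (∀ᵐ y ∂ν, g y ≠ ⊤) ∧ Integrable (fun y => (g y).toReal) ν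
  then ((∫ y, (g y).toReal ∂ν : ℝ) : EReal) else ⊤

/-- The semi-dual Brenier objective `J_{μ,ν}(f) = ∫ f dμ + ∫ f* dν`. -/
noncomputable def Jsd {d : ℕ} (μ ν : Measure (EuclideanSpace ℝ (Fin d)))
    (f : EuclideanSpace ℝ (Fin d) → ℝ) : EReal :=
  ((∫ x, f x ∂μ : ℝ) : EReal) + eintegral ν (conj f)

lemma grad_ineq {d : ℕ} {f : EuclideanSpace ℝ (Fin d) → ℝ} {T : EuclideanSpace ℝ (Fin d)}
    {x : EuclideanSpace ℝ (Fin d)} (hf : ConvexOn ℝ Set.univ f) (h : HasGradientAt f T x)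
    (y : EuclideanSpace ℝ (Fin d)) : ⟪y, T⟫ - f y ≤ ⟪x, T⟫ - f x := by
  have hc : ConvexOn ℝ Set.univ (fun t : ℝ => f (AffineMap.lineMap x y t)) := by
    exact hf.comp_affineMap (AffineMap.lineMap x y : ℝ →ᵃ[ℝ] EuclideanSpace ℝ (Fin d))
  have hd : HasDerivAt (fun t : ℝ => f (AffineMap.lineMap x y t)) ⟪T, y - x⟫ 0 := by
    have h1 : HasDerivAt (fun t : ℝ => (AffineMap.lineMap x y t : EuclideanSpace ℝ (Fin d)))
        (y - x) 0 := AffineMap.hasDerivAt_lineMap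
    have h2 := h.hasFDerivAt
    have h3 : HasFDerivAt f (InnerProductSpace.toDual ℝ _ T)
        (AffineMap.lineMap x y (0 : ℝ) : EuclideanSpace ℝ (Fin d)) := by simpa using h2
    exact h3.comp_hasDerivAt (0 : ℝ) h1
  have := hc.le_slope_of_hasDerivAt (Set.mem_univ 0) (Set.mem_univ 1) one_pos hd
  simp [slope_def_field, inner_sub_right] at this
  rw [real_inner_comm T y, real_inner_comm T x]
  linarith

lemma conj_grad {d : ℕ} {f : EuclideanSpace ℝ (Fin d) → ℝ} {T : EuclideanSpace ℝ (Fin d)}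
    {x : EuclideanSpace ℝ (Fin d)} (hf : ConvexOn ℝ Set.univ f) (h : HasGradientAt f T x) :
    conj f T = ((⟪x, T⟫ - f x : ℝ) : EReal) := by
  apply le_antisymm
  · exact iSup_le fun y => EReal.coe_le_coe_iff.2 (grad_ineq hf h y)
  · exact le_iSup (fun x => ((⟪x, T⟫ - f x : ℝ) : EReal)) x

lemma conj_measurable {d : ℕ} (f : EuclideanSpace ℝ (Fin d) → ℝ) : Measurable (conj f) := by
  apply LowerSemicontinuous.measurable
  apply lowerSemicontinuous_iSup
  intro x
  apply Continuous.lowerSemicontinuous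
  exact continuous_coe_real_ereal.comp (by fun_prop)

lemma integrable_of_cont {d : ℕ} {K : Set (EuclideanSpace ℝ (Fin d))} (hK : IsCompact K)
    {μ : Measure (EuclideanSpace ℝ (Fin d))} [IsProbabilityMeasure μ] (hμ : μ Kᶜ = 0)
    {g : EuclideanSpace ℝ (Fin d) → ℝ} (hg : Continuous g) : Integrable g μ := by
  have h1 : IntegrableOn g K μ := hg.continuousOn.integrableOn_compact hK
  have h2 : μ.restrict K = μ := Measure.restrict_eq_self_of_ae_mem (by
    rw [ae_iff]; exact hμ)
  rwa [IntegrableOn, h2] at h1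

/-- For a `C¹`, `γ`-strongly convex `f` (whose conjugate `f*` is then
finite-valued and differentiable, with gradient `gstar`),
`J(f) - J(f₀) = ∫ D_{f*}(T₀ x, ∇f x) dμ(x)`, where `D_{f*}` is the Bregman divergence
of `f*`. -/
theorem stmt_2 {d : ℕ} (X Y : Set (EuclideanSpace ℝ (Fin d)))
    (hX : IsCompact X) (hY : IsCompact Y)
    (μ ν : Measure (EuclideanSpace ℝ (Fin d)))
    [IsProbabilityMeasure μ] [IsProbabilityMeasure ν]
    (hμX : μ Xᶜ = 0) (hνY : ν Yᶜ = 0)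
    (f₀ : EuclideanSpace ℝ (Fin d) → ℝ)
    (T₀ : EuclideanSpace ℝ (Fin d) → EuclideanSpace ℝ (Fin d))
    (hconv : ConvexOn ℝ Set.univ f₀)
    (hgrad₀ : ∀ x, HasGradientAt f₀ (T₀ x) x)
    (hpush : Measure.map T₀ μ = ν)
    (γ : ℝ) (hγ : 0 < γ)
    (f : EuclideanSpace ℝ (Fin d) → ℝ)
    (Tf : EuclideanSpace ℝ (Fin d) → EuclideanSpace ℝ (Fin d))
    (hC1 : ContDiff ℝ 1 f)
    (hsc : ConvexOn ℝ Set.univ (fun x => f x - γ / 2 * ‖x‖ ^ 2))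
    (hgradf : ∀ x, HasGradientAt f (Tf x) x)
    -- the conjugate `f*` is finite-valued …
    (hfin : ∀ y, conj f y ≠ ⊤)
    -- … and differentiable on `ℝ^d`, with gradient `gstar`
    (gstar : EuclideanSpace ℝ (Fin d) → EuclideanSpace ℝ (Fin d))
    (hgstar : ∀ y, HasGradientAt (fun y => (conj f y).toReal) (gstar y) y) :
    Jsd μ ν f - Jsd μ ν f₀
      = ((∫ x, ((conj f (T₀ x)).toReal - (conj f (Tf x)).toReal
            - ⟪T₀ x - Tf x, gstar (Tf x)⟫) ∂μ : ℝ) : EReal) := by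
  have hcf : ConvexOn ℝ Set.univ f := by
    have h1 : ConvexOn ℝ Set.univ (fun x : EuclideanSpace ℝ (Fin d) => ‖x‖ ^ 2) :=
      convexOn_univ_norm.pow (fun _ _ => norm_nonneg _) 2
    have h2 := hsc.add (h1.smul (by positivity : 0 ≤ γ / 2))
    refine h2.congr fun x _ => ?_
    simp
  have hT₀ : AEMeasurable T₀ μ := by
    by_contra h
    rw [Measure.map_of_not_aemeasurable h] at hpush
    exact IsProbabilityMeasure.ne_zero ν hpush.symm
  have hf₀c : Continuous f₀ := continuous_iff_continuousAt.2 fun x => (hgrad₀ x).continuousAt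
  have hfsc : Continuous (fun y => (conj f y).toReal) :=
    continuous_iff_continuousAt.2 fun x => (hgstar x).continuousAt
  have hif := integrable_of_cont hX hμX hC1.continuous
  have hif₀ := integrable_of_cont hX hμX hf₀c
  have hifs := integrable_of_cont hY hνY hfsc
  have hTY : ∀ᵐ x ∂μ, T₀ x ∈ Y := by
    apply ae_of_ae_map hT₀
    rw [hpush, ae_iff]; exact hνY
  have hXm : ∀ᵐ x ∂μ, x ∈ X := by rw [ae_iff]; exact hμX
  have hin : Integrable (fun x => ⟪x, T₀ x⟫) μ := by
    obtain ⟨A, hA⟩ := hX.isBounded.exists_norm_le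
    obtain ⟨B, hB⟩ := hY.isBounded.exists_norm_le
    refine Integrable.of_bound (aemeasurable_id.inner hT₀).aestronglyMeasurable (A * B) ?_
    filter_upwards [hTY, hXm] with x h1 h2
    exact (norm_inner_le_norm _ _).trans (mul_le_mul (hA x h2) (hB _ h1) (norm_nonneg _)
      ((norm_nonneg _).trans (hA x h2)))
  have hc₀ : ∀ x, conj f₀ (T₀ x) = ((⟪x, T₀ x⟫ - f₀ x : ℝ) : EReal) :=
    fun x => conj_grad hconv (hgrad₀ x)
  have hc : ∀ x, conj f (Tf x) = ((⟪x, Tf x⟫ - f x : ℝ) : EReal) :=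
    fun x => conj_grad hcf (hgradf x)
  have hg : ∀ x, gstar (Tf x) = x := by
    intro x
    have hmin : IsLocalMin (fun y => (conj f y).toReal - ⟪x, y⟫) (Tf x) := by
      refine Filter.Eventually.of_forall fun y => ?_
      have h1 : ((⟪x, y⟫ - f x : ℝ) : EReal) ≤ conj f y :=
        le_iSup (fun x => ((⟪x, y⟫ - f x : ℝ) : EReal)) x
      have h2 := EReal.toReal_le_toReal h1 (EReal.coe_ne_bot _) (hfin y)
      rw [EReal.toReal_coe] at h2
      simp only [hc x, EReal.toReal_coe]
      linarith
    have hd := (hgstar (Tf x)).hasFDerivAt.sub (innerSL ℝ x).hasFDerivAt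
    have h0 := hmin.hasFDerivAt_eq_zero hd
    have h1 : ∀ v, ⟪gstar (Tf x), v⟫ = ⟪x, v⟫ := by
      intro v
      have := congrArg (fun L => L v) h0
      simp at this
      linarith
    exact ext_inner_right ℝ h1
  have hm₀ : AEStronglyMeasurable (fun y => (conj f₀ y).toReal) (Measure.map T₀ μ) :=
    (conj_measurable f₀).ereal_toReal.aestronglyMeasurable
  have hi₀ : Integrable (fun y => (conj f₀ y).toReal) ν := by
    rw [← hpush, integrable_map_measure hm₀ hT₀]
    refine (hin.sub hif₀).congr (Filter.Eventually.of_forall fun x => ?_)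
    simp only [Function.comp, Pi.sub_apply, hc₀ x, EReal.toReal_coe]
  have hv₀ : ∫ y, (conj f₀ y).toReal ∂ν = ∫ x, ⟪x, T₀ x⟫ ∂μ - ∫ x, f₀ x ∂μ := by
    rw [← hpush, integral_map hT₀ hm₀, ← integral_sub hin hif₀]
    simp only [hc₀, EReal.toReal_coe]
  have hnt : ∀ᵐ y ∂ν, conj f₀ y ≠ ⊤ := by
    rw [← hpush]
    refine (ae_map_iff hT₀ ((conj_measurable f₀) (measurableSet_singleton ⊤).compl)).2 ?_
    refine Filter.Eventually.of_forall fun x => ?_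
    change conj f₀ (T₀ x) ≠ ⊤
    rw [hc₀ x]; exact EReal.coe_ne_top _
  have hifs' : Integrable (fun x => (conj f (T₀ x)).toReal) μ := by
    rw [← hpush] at hifs
    exact hifs.comp_aemeasurable hT₀
  have hv : ∫ y, (conj f y).toReal ∂ν = ∫ x, (conj f (T₀ x)).toReal ∂μ := by
    rw [← hpush, integral_map hT₀ hfsc.aestronglyMeasurable]
  have hR : ∫ x, ((conj f (T₀ x)).toReal - (conj f (Tf x)).toReal
            - ⟪T₀ x - Tf x, gstar (Tf x)⟫) ∂μ
      = ∫ x, (conj f (T₀ x)).toReal ∂μ + ∫ x, f x ∂μ - ∫ x, ⟪x, T₀ x⟫ ∂μ := by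
    have hadd : Integrable (fun x => (conj f (T₀ x)).toReal + f x) μ := hifs'.add hif
    rw [← integral_add hifs' hif, ← integral_sub hadd hin]
    congr 1
    ext x
    rw [hg x, hc x, EReal.toReal_coe, inner_sub_left, real_inner_comm x (T₀ x),
      real_inner_comm x (Tf x)]
    ring
  rw [hR]
  unfold Jsd eintegral
  rw [if_pos ⟨Filter.Eventually.of_forall hfin, hifs⟩, if_pos ⟨hnt, hi₀⟩, hv, hv₀]
  norm_cast
  ring
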